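/- Under hypotheses (K1), (K2) and (G1), the value function φ is Lipschitz continuous on [0,∞) × Ω. -/

import Mathlib

open MeasureTheory Filter Set Metric
open scoped Topology RealInnerProductSpace NNReal ENNReal

noncomputable section

abbrev Evec (d : ℕ) := EuclideanSpace ℝ (Fin d)

variable {d : ℕ}

/-- An admissible control: a measurable function with values in the closed unit ball. -/
def IsControl (u : ℝ → Evec d) : Prop :=
  Measurable u ∧ ∀ t, ‖u t‖ ≤ 1

/-- `γ` is the (absolutely continuous) trajectory of the control system
`γ'(t) = k(t, γ(t)) u(t)` for a.e. `t ≥ t₀`, `γ(t₀) = x₀`, written in integral form. -/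
def IsTrajectory (k : ℝ → Evec d → ℝ) (t₀ : ℝ) (x₀ : Evec d) (u γ : ℝ → Evec d) : Prop :=
  ∀ t, t₀ ≤ t → γ t = x₀ + ∫ s in t₀..t, k s (γ s) • u s

/-- The set of nonnegative elapsed times at which a trajectory started at time `t₀`
lies on the boundary of `Ω`. -/
def exitSet (Ω : Set (Evec d)) (t₀ : ℝ) (γ : ℝ → Evec d) : Set ℝ :=
  {τ : ℝ | 0 ≤ τ ∧ γ (t₀ + τ) ∈ frontier Ω}

/-- The exit time `τ^{t₀,x₀,u}` (with junk value `sInf ∅ = 0` if the trajectory never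
reaches the boundary). -/
def exitTime (Ω : Set (Evec d)) (t₀ : ℝ) (γ : ℝ → Evec d) : ℝ :=
  sInf (exitSet Ω t₀ γ)

/-- The cost `τ^{t₀,x₀,u} + g(γ^{t₀,x₀,u}_τ)`. -/
def exitCost (Ω : Set (Evec d)) (g : Evec d → ℝ) (t₀ : ℝ) (γ : ℝ → Evec d) : ℝ :=
  exitTime Ω t₀ γ + g (γ (t₀ + exitTime Ω t₀ γ))

/-- The set of costs achievable from `(t₀, x₀)` by admissible controls whose
trajectory reaches the boundary. -/
def costSet (Ω : Set (Evec d)) (k : ℝ → Evec d → ℝ) (g : Evec d → ℝ)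
    (t₀ : ℝ) (x₀ : Evec d) : Set ℝ :=
  {r | ∃ u γ, IsControl u ∧ IsTrajectory k t₀ x₀ u γ ∧ (exitSet Ω t₀ γ).Nonempty ∧
    r = exitCost Ω g t₀ γ}

/-- The value function `φ(t, x)`. -/
def valueFun (Ω : Set (Evec d)) (k : ℝ → Evec d → ℝ) (g : Evec d → ℝ)
    (t : ℝ) (x : Evec d) : ℝ :=
  sInf (costSet Ω k g t x)

/-- `u` (with associated trajectory `γ`) is an optimal control for `x₀` at time `t₀`. -/
def IsOptimal (Ω : Set (Evec d)) (k : ℝ → Evec d → ℝ) (g : Evec d → ℝ)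
    (t₀ : ℝ) (x₀ : Evec d) (u γ : ℝ → Evec d) : Prop :=
  IsControl u ∧ IsTrajectory k t₀ x₀ u γ ∧ (exitSet Ω t₀ γ).Nonempty ∧
  IsLeast (costSet Ω k g t₀ x₀) (exitCost Ω g t₀ γ)

/-- Standing assumptions on the speed `k`: joint continuity, two-sided bounds and a Lipschitz
estimate in space. -/
structure IsSpeed (k : ℝ → Evec d → ℝ) (kmin kmax L : ℝ) : Prop where
  cont : ContinuousOn (fun p : ℝ × Evec d => k p.1 p.2) (Set.Ici 0 ×ˢ Set.univ)
  min_pos : 0 < kmin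
  bdd : ∀ t x, 0 ≤ t → kmin ≤ k t x ∧ k t x ≤ kmax
  lip_nonneg : 0 ≤ L
  lip : ∀ t, 0 ≤ t → ∀ x₁ x₂ : Evec d, |k t x₁ - k t x₂| ≤ L * ‖x₁ - x₂‖

/-- Starting from `x` at time `t`, the point `y` can be reached at time `T` along a path whose
velocity is bounded by the speed `k`. -/
def Reaches (k : ℝ → Evec d → ℝ) (t : ℝ) (x : Evec d) (T : ℝ) (y : Evec d) : Prop :=
  t ≤ T ∧ ∃ v : ℝ → Evec d, Measurable v ∧
    (∀ s ∈ Ioc t T, ‖v s‖ ≤ k s (x + ∫ r in t..s, v r)) ∧ x + ∫ r in t..T, v r = y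

namespace IsSpeed

variable {k : ℝ → Evec d → ℝ} {kmin kmax L : ℝ}

lemma max_pos (hk : IsSpeed k kmin kmax L) : 0 < kmax :=
  hk.min_pos.trans_le ((hk.bdd 0 0 le_rfl).1.trans (hk.bdd 0 0 le_rfl).2)

lemma continuousOn_comp (hk : IsSpeed k kmin kmax L) {γ : ℝ → Evec d} {S : Set ℝ}
    (hS : S ⊆ Ici 0) (hγ : ContinuousOn γ S) : ContinuousOn (fun s => k s (γ s)) S :=
  hk.cont.comp (f := fun s => (s, γ s)) (continuousOn_id.prodMk hγ) fun _ hs => ⟨hS hs, mem_univ _⟩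

end IsSpeed

lemma intervalIntegrable_of_norm_le {v : ℝ → Evec d} (hv : Measurable v) {t T C : ℝ}
    (hb : ∀ s ∈ Ioc t T, ‖v s‖ ≤ C) {a b : ℝ} (ha : t ≤ a) (hab : a ≤ b) (hbT : b ≤ T) :
    IntervalIntegrable v volume a b := by
  rw [intervalIntegrable_iff_integrableOn_Ioc_of_le hab]
  refine Measure.integrableOn_of_bounded (M := C) (by simp) hv.aestronglyMeasurable ?_
  filter_upwards [ae_restrict_mem measurableSet_Ioc] with s hs
  exact hb s ⟨ha.trans_lt hs.1, hs.2.trans hbT⟩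

section Reaches

variable {k : ℝ → Evec d → ℝ} {kmin kmax L : ℝ}

lemma Reaches.of_const (hk : IsSpeed k kmin kmax L) {t T : ℝ} (ht : 0 ≤ t) (hT : t ≤ T)
    (x c : Evec d) (hc : ‖c‖ ≤ kmin) : Reaches k t x T (x + (T - t) • c) :=
  ⟨hT, fun _ => c, measurable_const,
    fun _ hs => hc.trans (hk.bdd _ _ (ht.trans hs.1.le)).1, by simp⟩

lemma Reaches.straight (hk : IsSpeed k kmin kmax L) {t : ℝ} (ht : 0 ≤ t) (x y : Evec d) :
    Reaches k t x (t + ‖y - x‖ / kmin) y := by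
  have hmin := hk.min_pos
  rcases eq_or_ne (y - x) 0 with h | h
  · have := Reaches.of_const hk ht le_rfl x 0 (by simpa using hmin.le)
    rw [sub_eq_zero] at h
    simpa [h] using this
  · have hn : 0 < ‖y - x‖ := norm_pos_iff.2 h
    have := Reaches.of_const hk (T := t + ‖y - x‖ / kmin) ht (by
      have := div_nonneg hn.le hmin.le
      linarith) x ((kmin / ‖y - x‖) • (y - x)) (by
      rw [norm_smul, Real.norm_of_nonneg (by positivity)]
      field_simp
      exact le_rfl)
    rw [add_sub_cancel_left, smul_smul, show ‖y - x‖ / kmin * (kmin / ‖y - x‖) = 1 by field_simp,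
      one_smul, add_sub_cancel] at this
    exact this

lemma Reaches.trans (hk : IsSpeed k kmin kmax L) {t T₁ T₂ : ℝ} {x y z : Evec d} (ht : 0 ≤ t)
    (h₁ : Reaches k t x T₁ y) (h₂ : Reaches k T₁ y T₂ z) : Reaches k t x T₂ z := by
  obtain ⟨hT₁, v₁, hm₁, hb₁, rfl⟩ := h₁
  obtain ⟨hT₂, v₂, hm₂, hb₂, rfl⟩ := h₂
  set v : ℝ → Evec d := (Iic T₁).piecewise v₁ v₂ with hv
  have hm : Measurable v := hm₁.piecewise measurableSet_Iic hm₂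
  have e₁ : ∀ s ∈ Icc t T₁, ∫ r in t..s, v r = ∫ r in t..s, v₁ r := by
    intro s hs
    refine intervalIntegral.integral_congr_ae (ae_of_all _ fun r hr => ?_)
    rw [uIoc_of_le hs.1] at hr
    exact piecewise_eq_of_mem _ _ _ (hr.2.trans hs.2)
  have e₂ : ∀ s ∈ Icc T₁ T₂, ∫ r in T₁..s, v r = ∫ r in T₁..s, v₂ r := by
    intro s hs
    refine intervalIntegral.integral_congr_ae (ae_of_all _ fun r hr => ?_)
    rw [uIoc_of_le hs.1] at hr
    exact piecewise_eq_of_notMem _ _ _ (not_le.2 hr.1)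
  have hbd : ∀ s ∈ Ioc t T₂, ‖v s‖ ≤ kmax := by
    intro s hs
    rcases le_or_gt s T₁ with h | h
    · rw [hv, piecewise_eq_of_mem _ _ _ (show s ∈ Iic T₁ from h)]
      exact (hb₁ s ⟨hs.1, h⟩).trans (hk.bdd s _ (ht.trans hs.1.le)).2
    · rw [hv, piecewise_eq_of_notMem _ _ _ (show s ∉ Iic T₁ from not_le.2 h)]
      exact (hb₂ s ⟨h, hs.2⟩).trans (hk.bdd s _ (ht.trans hs.1.le)).2
  have e₃ : ∀ s ∈ Icc T₁ T₂,
      ∫ r in t..s, v r = (∫ r in t..T₁, v₁ r) + ∫ r in T₁..s, v₂ r := by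
    intro s hs
    rw [← e₁ T₁ ⟨hT₁, le_rfl⟩, ← e₂ s hs, intervalIntegral.integral_add_adjacent_intervals]
    · exact intervalIntegrable_of_norm_le hm hbd le_rfl hT₁ hT₂
    · exact intervalIntegrable_of_norm_le hm hbd hT₁ hs.1 hs.2
  refine ⟨hT₁.trans hT₂, v, hm, fun s hs => ?_, ?_⟩
  · rcases le_or_gt s T₁ with h | h
    · rw [e₁ s ⟨hs.1.le, h⟩, hv, piecewise_eq_of_mem _ _ _ (show s ∈ Iic T₁ from h)]
      exact hb₁ s ⟨hs.1, h⟩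
    · rw [e₃ s ⟨h.le, hs.2⟩, hv, piecewise_eq_of_notMem _ _ _ (show s ∉ Iic T₁ from not_le.2 h),
        ← add_assoc]
      exact hb₂ s ⟨h, hs.2⟩
  · rw [e₃ T₂ ⟨hT₂, le_rfl⟩, add_assoc]

lemma Reaches.norm_sub_le (hk : IsSpeed k kmin kmax L) {t T : ℝ} {x y : Evec d} (ht : 0 ≤ t)
    (h : Reaches k t x T y) : ‖y - x‖ ≤ kmax * (T - t) := by
  obtain ⟨hT, v, -, hb, rfl⟩ := h
  have := intervalIntegral.norm_integral_le_of_norm_le_const (f := v) (a := t) (b := T) (C := kmax)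
    (fun s hs => by
      rw [uIoc_of_le hT] at hs
      exact (hb s hs).trans (hk.bdd s _ (ht.trans hs.1.le)).2)
  rw [abs_of_nonneg (sub_nonneg.2 hT)] at this
  rwa [add_sub_cancel_left]

lemma Reaches.split (hk : IsSpeed k kmin kmax L) {t s T : ℝ} {x y : Evec d} (ht : 0 ≤ t)
    (h : Reaches k t x T y) (hts : t ≤ s) (hsT : s ≤ T) :
    ∃ z, Reaches k t x s z ∧ Reaches k s z T y := by
  obtain ⟨hT, v, hm, hb, rfl⟩ := h
  have hbd : ∀ s ∈ Ioc t T, ‖v s‖ ≤ kmax := fun s hs =>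
    (hb s hs).trans (hk.bdd s _ (ht.trans hs.1.le)).2
  have e : ∀ r ∈ Icc s T, (x + ∫ q in t..s, v q) + ∫ q in s..r, v q = x + ∫ q in t..r, v q := by
    intro r hr
    rw [add_assoc, intervalIntegral.integral_add_adjacent_intervals]
    · exact intervalIntegrable_of_norm_le hm hbd le_rfl hts hsT
    · exact intervalIntegrable_of_norm_le hm hbd hts hr.1 hr.2
  refine ⟨x + ∫ q in t..s, v q,
    ⟨hts, v, hm, fun r hr => hb r ⟨hr.1, hr.2.trans hsT⟩, rfl⟩,
    hsT, v, hm, fun r hr => ?_, e T ⟨hsT, le_rfl⟩⟩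
  rw [e r ⟨hr.1.le, hr.2⟩]
  exact hb r ⟨hts.trans_lt hr.1, hr.2⟩

/-- Slowing a path down suitably yields an admissible path from a nearby starting point which
stays close to the original one, on the same time interval. -/
lemma Reaches.perturb (hk : IsSpeed k kmin kmax L) {t T : ℝ} {x y : Evec d} (ht : 0 ≤ t)
    (h : Reaches k t x T y) (x' : Evec d) :
    ∃ y', Reaches k t x' T y' ∧
      ‖y' - y‖ ≤ ‖x' - x‖ * Real.exp (L / kmin * kmax * (T - t)) := by
  obtain ⟨hT, v, hm, hb, rfl⟩ := h
  have hmin := hk.min_pos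
  have hL := hk.lip_nonneg
  have hbd : ∀ s ∈ Ioc t T, ‖v s‖ ≤ kmax := fun s hs =>
    (hb s hs).trans (hk.bdd s _ (ht.trans hs.1.le)).2
  set E : ℝ → ℝ := fun s => ‖x' - x‖ * Real.exp (L / kmin * kmax * (s - t)) with hE
  have hE0 : ∀ s, 0 ≤ E s := fun _ => by positivity
  have hEc : Continuous E := by fun_prop
  set α : ℝ → ℝ := fun s => max 0 (1 - L / kmin * E s) with hα
  have hαc : Continuous α := by fun_prop
  have hα0 : ∀ s, 0 ≤ α s := fun s => le_max_left _ _
  have hα1 : ∀ s, α s ≤ 1 := fun s => by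
    have := hE0 s
    exact max_le zero_le_one (sub_le_self _ (by positivity))
  have hm' : Measurable fun s => α s • v s := hαc.measurable.smul hm
  have hbd' : ∀ s ∈ Ioc t T, ‖α s • v s‖ ≤ kmax := fun s hs => by
    rw [norm_smul, Real.norm_of_nonneg (hα0 s)]
    exact (mul_le_of_le_one_left (norm_nonneg _) (hα1 s)).trans (hbd s hs)
  have hEint : ∀ s, ∫ r in t..s, L / kmin * kmax * E r = E s - ‖x' - x‖ := by
    intro s
    have hd : ∀ r ∈ uIcc t s, HasDerivAt E (L / kmin * kmax * E r) r := by
      intro r _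
      have h1 : HasDerivAt (fun r => L / kmin * kmax * (r - t)) (L / kmin * kmax) r := by
        simpa using ((hasDerivAt_id r).sub_const t).const_mul (L / kmin * kmax)
      refine (h1.exp.const_mul ‖x' - x‖).congr_deriv ?_
      simp only [hE]
      ring
    rw [intervalIntegral.integral_eq_sub_of_hasDerivAt hd
      (Continuous.intervalIntegrable (by fun_prop) _ _)]
    simp [hE]
  have key : ∀ s ∈ Icc t T,
      ‖(x' + ∫ r in t..s, α r • v r) - (x + ∫ r in t..s, v r)‖ ≤ E s := by
    intro s hs
    have h1 : (x' + ∫ r in t..s, α r • v r) - (x + ∫ r in t..s, v r)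
        = (x' - x) + ∫ r in t..s, (α r • v r - v r) := by
      rw [intervalIntegral.integral_sub
        (intervalIntegrable_of_norm_le hm' hbd' le_rfl hs.1 hs.2)
        (intervalIntegrable_of_norm_le hm hbd le_rfl hs.1 hs.2)]
      abel
    have h2 : ‖∫ r in t..s, (α r • v r - v r)‖ ≤ ∫ r in t..s, L / kmin * kmax * E r := by
      refine intervalIntegral.norm_integral_le_of_norm_le hs.1 (ae_of_all _ fun r hr => ?_)
        (Continuous.intervalIntegrable (by fun_prop) _ _)
      have h3 : α r • v r - v r = -((1 - α r) • v r) := by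
        rw [sub_smul, one_smul, neg_sub]
      rw [h3, norm_neg, norm_smul, Real.norm_of_nonneg (sub_nonneg.2 (hα1 r))]
      have h4 : 1 - α r ≤ L / kmin * E r := by
        have : 1 - L / kmin * E r ≤ α r := le_max_right _ _
        linarith
      have h5 := hE0 r
      calc (1 - α r) * ‖v r‖ ≤ (L / kmin * E r) * kmax :=
            mul_le_mul h4 (hbd r ⟨hr.1, hr.2.trans hs.2⟩) (norm_nonneg _) (by positivity)
        _ = _ := by ring
    rw [hEint] at h2
    rw [h1]
    linarith [norm_add_le (x' - x) (∫ r in t..s, (α r • v r - v r))]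
  refine ⟨x' + ∫ r in t..T, α r • v r, ⟨hT, fun s => α s • v s, hm', fun s hs => ?_, rfl⟩,
    key T ⟨hT, le_rfl⟩⟩
  have hs0 : 0 ≤ s := ht.trans hs.1.le
  have hd := key s ⟨hs.1.le, hs.2⟩
  set p := x' + ∫ r in t..s, α r • v r
  set q := x + ∫ r in t..s, v r with hq
  have hv := hb s hs
  rw [← hq] at hv
  rw [norm_smul, Real.norm_of_nonneg (hα0 s)]
  obtain ⟨hp1, -⟩ := hk.bdd s p hs0
  obtain ⟨hq1, -⟩ := hk.bdd s q hs0
  rcases le_total (1 - L / kmin * E s) 0 with h0 | h0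
  · rw [show α s = 0 from max_eq_left h0, zero_mul]
    exact hmin.le.trans hp1
  · rw [show α s = _ from max_eq_right h0]
    have h1 := (abs_le.1 (hk.lip s hs0 p q)).1
    have h2 : L * ‖p - q‖ ≤ L * E s := mul_le_mul_of_nonneg_left hd hL
    have h3 : L * E s ≤ L / kmin * E s * k s q := by
      have := hE0 s
      calc L * E s = L / kmin * E s * kmin := by field_simp
        _ ≤ _ := mul_le_mul_of_nonneg_left hq1 (by positivity)
    have h4 : (1 - L / kmin * E s) * ‖v s‖ ≤ (1 - L / kmin * E s) * k s q :=
      mul_le_mul_of_nonneg_left hv h0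
    linarith

/-- A path realising `Reaches` extends to a trajectory of the control system on `[t, ∞)`. -/
lemma Reaches.exists_trajectory (hk : IsSpeed k kmin kmax L) {t T : ℝ} {x y : Evec d} (ht : 0 ≤ t)
    (h : Reaches k t x T y) : ∃ u γ, IsControl u ∧ IsTrajectory k t x u γ ∧ γ T = y := by
  obtain ⟨hT, v, hm, hb, rfl⟩ := h
  have hbd : ∀ s ∈ Ioc t T, ‖v s‖ ≤ kmax := fun s hs =>
    (hb s hs).trans (hk.bdd s _ (ht.trans hs.1.le)).2
  set w : ℝ → Evec d := (Ioc t T).indicator v with hw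
  have hwi : Integrable w := by
    rw [hw, integrable_indicator_iff measurableSet_Ioc,
      ← intervalIntegrable_iff_integrableOn_Ioc_of_le hT]
    exact intervalIntegrable_of_norm_le hm hbd le_rfl hT le_rfl
  set γ : ℝ → Evec d := fun s => x + ∫ r in t..s, w r with hγ
  have hγc : Continuous γ :=
    continuous_const.add (intervalIntegral.continuous_primitive
      (fun a b => hwi.intervalIntegrable) t)
  have e : ∀ s ∈ Icc t T, γ s = x + ∫ r in t..s, v r := by
    intro s hs
    simp only [hγ]
    congr 1
    refine intervalIntegral.integral_congr_ae (ae_of_all _ fun r hr => ?_)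
    rw [uIoc_of_le hs.1] at hr
    exact indicator_of_mem (show r ∈ Ioc t T from ⟨hr.1, hr.2.trans hs.2⟩) _
  have hkc : Continuous fun s => k (max s 0) (γ s) :=
    hk.cont.comp_continuous (f := fun s => (max s 0, γ s)) (by fun_prop)
      fun s => ⟨mem_Ici.2 (le_max_right _ _), mem_univ _⟩
  refine ⟨(Ioc t T).indicator fun s => (k (max s 0) (γ s))⁻¹ • v s, γ, ⟨?_, fun s => ?_⟩,
    fun s hs => ?_, e T ⟨hT, le_rfl⟩⟩
  · exact (hkc.measurable.inv.smul hm).indicator measurableSet_Ioc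
  · by_cases hs : s ∈ Ioc t T
    · have hs0 : 0 ≤ s := ht.trans hs.1.le
      have hpos : 0 < k s (γ s) := hk.min_pos.trans_le (hk.bdd s _ hs0).1
      rw [indicator_of_mem hs, max_eq_left hs0, norm_smul, norm_inv, Real.norm_of_nonneg hpos.le,
        inv_mul_le_one₀ hpos, e s ⟨hs.1.le, hs.2⟩]
      exact hb s hs
    · simp [indicator_of_notMem hs]
  · simp only [hγ]
    congr 1
    refine intervalIntegral.integral_congr_ae (ae_of_all _ fun r hr => ?_)
    rw [uIoc_of_le hs] at hr
    by_cases hr' : r ∈ Ioc t T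
    · have hr0 : 0 ≤ r := ht.trans hr.1.le
      have hpos : 0 < k r (γ r) := hk.min_pos.trans_le (hk.bdd r _ hr0).1
      rw [hw, indicator_of_mem hr', indicator_of_mem hr', max_eq_left hr0]
      exact (smul_inv_smul₀ hpos.ne' _).symm
    · simp [hw, indicator_of_notMem hr']

end Reaches

section Trajectory

variable {k : ℝ → Evec d → ℝ} {kmin kmax L : ℝ}

lemma IsTrajectory.intervalIntegrable (hk : IsSpeed k kmin kmax L) {t : ℝ} {x : Evec d}
    {u γ : ℝ → Evec d} (ht : 0 ≤ t) (hu : IsControl u) (hγ : IsTrajectory k t x u γ) {b : ℝ}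
    (hb : t ≤ b) : IntervalIntegrable (fun s => k s (γ s) • u s) volume t b := by
  set f : ℝ → Evec d := fun s => k s (γ s) • u s with hf
  set S : Set ℝ := {s | t ≤ s ∧ IntervalIntegrable f volume t s} with hS
  have hS0 : S ⊆ Ici 0 := fun s hs => ht.trans hs.1
  have hSsub : ∀ s ∈ S, Icc t s ⊆ S := fun s hs r hr =>
    ⟨hr.1, hs.2.mono_set (by rw [uIcc_of_le hr.1, uIcc_of_le hs.1]; exact Icc_subset_Icc_right hr.2)⟩
  have hSm : MeasurableSet S := by
    have : OrdConnected S := ⟨fun a ha b hb r hr => hSsub b hb ⟨ha.1.trans hr.1, hr.2⟩⟩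
    exact this.measurableSet
  have hcIcc : ∀ s ∈ S, ContinuousOn γ (Icc t s) := by
    intro s hs
    have h1 := intervalIntegral.continuousOn_primitive_interval' hs.2 left_mem_uIcc
    rw [uIcc_of_le hs.1] at h1
    exact (continuousOn_const.add h1).congr fun r hr => hγ r hr.1
  have hcS : ContinuousOn γ S := by
    intro s hs
    by_cases h : ∃ c ∈ S, s < c
    · obtain ⟨c, hc, hsc⟩ := h
      refine (hcIcc c hc s ⟨hs.1, hsc.le⟩).mono_of_mem_nhdsWithin ?_
      filter_upwards [self_mem_nhdsWithin, nhdsWithin_le_nhds (Iio_mem_nhds hsc)] with r hr hrc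
      exact ⟨hr.1, le_of_lt hrc⟩
    · push Not at h
      exact (hcIcc s hs s ⟨hs.1, le_rfl⟩).mono fun r hr => ⟨hr.1, h r hr⟩
  have hmS : AEStronglyMeasurable f (volume.restrict S) :=
    ((hk.continuousOn_comp hS0 hcS).aestronglyMeasurable hSm).smul
      hu.1.aestronglyMeasurable
  have hmC : AEStronglyMeasurable f (volume.restrict (Ici t \ S)) := by
    have hm : MeasurableSet (Ici t \ S) := measurableSet_Ici.diff hSm
    have h1 : ContinuousOn (fun s => k s x) (Ici t \ S) :=
      hk.continuousOn_comp (γ := fun _ => x) (fun s hs => ht.trans hs.1) continuousOn_const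
    refine ((h1.aestronglyMeasurable hm).smul
      hu.1.aestronglyMeasurable).congr ?_
    filter_upwards [ae_restrict_mem hm] with s hs
    have h2 : γ s = x := by
      rw [hγ s hs.1, intervalIntegral.integral_undef fun h => hs.2 ⟨hs.1, h⟩, add_zero]
    simp [hf, h2]
  have hmf : AEStronglyMeasurable f (volume.restrict (Ici t)) := by
    have := aestronglyMeasurable_union_iff.2 ⟨hmS, hmC⟩
    refine this.mono_measure (Measure.restrict_mono (fun s hs => ?_) le_rfl)
    by_cases h : s ∈ S
    · exact Or.inl h
    · exact Or.inr ⟨hs, h⟩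
  rw [intervalIntegrable_iff_integrableOn_Ioc_of_le hb]
  refine Integrable.of_bound ?_ kmax ?_
  · exact hmf.mono_measure 
      (Measure.restrict_mono (Ioc_subset_Icc_self.trans Icc_subset_Ici_self) le_rfl)
  · filter_upwards [ae_restrict_mem measurableSet_Ioc] with s hs
    obtain ⟨h1, h2⟩ := hk.bdd s (γ s) (ht.trans hs.1.le)
    rw [hf, norm_smul, Real.norm_of_nonneg (hk.min_pos.le.trans h1)]
    exact (mul_le_of_le_one_right (hk.min_pos.le.trans h1) (hu.2 s)).trans h2

lemma IsTrajectory.continuousOn (hk : IsSpeed k kmin kmax L) {t : ℝ} {x : Evec d}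
    {u γ : ℝ → Evec d} (ht : 0 ≤ t) (hu : IsControl u) (hγ : IsTrajectory k t x u γ) :
    ContinuousOn γ (Ici t) := by
  intro s hs
  have hs1 : t ≤ s + 1 := by linarith [mem_Ici.1 hs]
  have h1 := intervalIntegral.continuousOn_primitive_interval'
    (hγ.intervalIntegrable hk ht hu hs1) left_mem_uIcc
  rw [uIcc_of_le hs1] at h1
  have h2 : ContinuousOn γ (Icc t (s + 1)) :=
    (continuousOn_const.add h1).congr fun r hr => hγ r hr.1
  refine (h2 s ⟨hs, by linarith⟩).mono_of_mem_nhdsWithin ?_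
  filter_upwards [self_mem_nhdsWithin, nhdsWithin_le_nhds (Iio_mem_nhds (lt_add_one s))]
    with r hr hrc
  exact ⟨hr, le_of_lt hrc⟩

lemma IsTrajectory.reaches (hk : IsSpeed k kmin kmax L) {t : ℝ} {x : Evec d}
    {u γ : ℝ → Evec d} (ht : 0 ≤ t) (hu : IsControl u) (hγ : IsTrajectory k t x u γ) {T : ℝ}
    (hT : t ≤ T) : Reaches k t x T (γ T) := by
  have hc := hγ.continuousOn hk ht hu
  have hc' : Continuous fun s => γ (max s t) :=
    hc.comp_continuous (by fun_prop) fun s => mem_Ici.2 (le_max_right _ _)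
  have hkc : Continuous fun s => k (max s t) (γ (max s t)) :=
    hk.cont.comp_continuous (f := fun s => (max s t, γ (max s t))) 
      ((continuous_id.max continuous_const).prodMk hc')
      fun s => ⟨mem_Ici.2 (ht.trans (le_max_right _ _)), mem_univ _⟩
  have e : ∀ s, t ≤ s → x + ∫ r in t..s, k (max r t) (γ (max r t)) • u r = γ s := by
    intro s hs
    rw [hγ s hs]
    congr 1
    refine intervalIntegral.integral_congr_ae (ae_of_all _ fun r hr => ?_)
    rw [uIoc_of_le hs] at hr
    simp only [max_eq_left hr.1.le]
  refine ⟨hT, fun s => k (max s t) (γ (max s t)) • u s, hkc.measurable.smul hu.1,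
    fun s hs => ?_, e T hT⟩
  have h1 := (hk.bdd s (γ s) (ht.trans hs.1.le)).1
  rw [e s hs.1.le]
  simp only [max_eq_left hs.1.le]
  rw [norm_smul, Real.norm_of_nonneg (hk.min_pos.le.trans h1)]
  exact mul_le_of_le_one_right (hk.min_pos.le.trans h1) (hu.2 s)

lemma IsTrajectory.restart (hk : IsSpeed k kmin kmax L) {t : ℝ} {x : Evec d}
    {u γ : ℝ → Evec d} (ht : 0 ≤ t) (hu : IsControl u) (hγ : IsTrajectory k t x u γ) {s : ℝ}
    (hs : t ≤ s) : IsTrajectory k s (γ s) u γ := by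
  intro r hr
  have hts := hγ.intervalIntegrable hk ht hu hs
  have htr := hγ.intervalIntegrable hk ht hu (hs.trans hr)
  rw [hγ r (hs.trans hr), hγ s hs, add_assoc,
    intervalIntegral.integral_add_adjacent_intervals hts (hts.symm.trans htr)]

lemma IsTrajectory.exitTime_mem (hk : IsSpeed k kmin kmax L) {Ω : Set (Evec d)} {t : ℝ}
    {x : Evec d} {u γ : ℝ → Evec d} (ht : 0 ≤ t) (hu : IsControl u)
    (hγ : IsTrajectory k t x u γ) (hne : (exitSet Ω t γ).Nonempty) :
    exitTime Ω t γ ∈ exitSet Ω t γ := by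
  refine IsClosed.csInf_mem ?_ hne ⟨0, fun τ hτ => hτ.1⟩
  have hc : ContinuousOn (fun τ => γ (t + τ)) (Ici 0) :=
    (hγ.continuousOn hk ht hu).comp (by fun_prop) fun τ hτ => by
      simpa using hτ
  exact hc.preimage_isClosed_of_isClosed isClosed_Ici isClosed_frontier

end Trajectory

section Value

variable {k : ℝ → Evec d → ℝ} {kmin kmax L : ℝ} {Ω : Set (Evec d)} {g : Evec d → ℝ}

lemma costSet_nonneg (hk : IsSpeed k kmin kmax L) (hg0 : ∀ x ∈ frontier Ω, 0 ≤ g x)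
    {t : ℝ} (ht : 0 ≤ t) {x : Evec d} : ∀ r ∈ costSet Ω k g t x, 0 ≤ r := by
  rintro r ⟨u, γ, hu, hγ, hne, rfl⟩
  obtain ⟨h1, h2⟩ := hγ.exitTime_mem hk ht hu hne
  exact add_nonneg h1 (hg0 _ h2)

/-- Reaching the boundary, even after a first visit to it, bounds the value function. -/
lemma Reaches.valueFun_le (hk : IsSpeed k kmin kmax L) (hg0 : ∀ x ∈ frontier Ω, 0 ≤ g x)
    {lam : ℝ} (hlam : 0 < lam) (hlamk : lam < 1 / kmax)
    (hglip : ∀ x ∈ frontier Ω, ∀ y ∈ frontier Ω, |g x - g y| ≤ lam * ‖x - y‖)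
    {t T : ℝ} (ht : 0 ≤ t) {x y : Evec d} (h : Reaches k t x T y) (hy : y ∈ frontier Ω) :
    valueFun Ω k g t x ≤ T - t + g y := by
  have hT := h.1
  obtain ⟨u, γ, hu, hγ, rfl⟩ := h.exists_trajectory hk ht
  have hmem : T - t ∈ exitSet Ω t γ := ⟨sub_nonneg.2 hT, by rwa [add_sub_cancel]⟩
  have hle : exitTime Ω t γ ≤ T - t := csInf_le ⟨0, fun τ hτ => hτ.1⟩ hmem
  obtain ⟨h1, h2⟩ := hγ.exitTime_mem hk ht hu ⟨_, hmem⟩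
  have h3 : valueFun Ω k g t x ≤ exitCost Ω g t γ :=
    csInf_le ⟨0, costSet_nonneg hk hg0 ht⟩ ⟨u, γ, hu, hγ, ⟨_, hmem⟩, rfl⟩
  refine h3.trans ?_
  unfold exitCost
  set τ := exitTime Ω t γ
  have hr : Reaches k (t + τ) (γ (t + τ)) T (γ T) :=
    (hγ.restart hk ht hu (by linarith)).reaches hk (by linarith) hu (by linarith)
  have h4 := hr.norm_sub_le hk (by linarith)
  have h5 := (abs_le.1 (hglip _ hy _ h2)).1
  have h6 : lam * kmax ≤ 1 := by
    rw [lt_div_iff₀ hk.max_pos] at hlamk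
    exact hlamk.le
  have h7 : lam * ‖γ T - γ (t + τ)‖ ≤ T - (t + τ) := by
    calc _ ≤ lam * (kmax * (T - (t + τ))) := mul_le_mul_of_nonneg_left h4 hlam.le
      _ = lam * kmax * (T - (t + τ)) := by ring
      _ ≤ 1 * (T - (t + τ)) := mul_le_mul_of_nonneg_right h6 (by linarith)
      _ = _ := one_mul _
  linarith

lemma exists_reaches_lt (hk : IsSpeed k kmin kmax L)
    (hne : (frontier Ω).Nonempty) {t : ℝ} (ht : 0 ≤ t) (x : Evec d) {ε : ℝ} (hε : 0 < ε) :
    ∃ T, ∃ y ∈ frontier Ω, Reaches k t x T y ∧ T - t + g y < valueFun Ω k g t x + ε := by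
  have hcne : (costSet Ω k g t x).Nonempty := by
    obtain ⟨y, hy⟩ := hne
    have h := Reaches.straight hk ht x y
    obtain ⟨u, γ, hu, hγ, hy'⟩ := h.exists_trajectory hk ht
    have hT := h.1
    exact ⟨_, u, γ, hu, hγ, ⟨‖y - x‖ / kmin, by linarith, by rwa [hy']⟩, rfl⟩
  obtain ⟨r, ⟨u, γ, hu, hγ, hex, rfl⟩, hr⟩ :=
    exists_lt_of_csInf_lt hcne (lt_add_of_pos_right (valueFun Ω k g t x) hε)
  obtain ⟨h1, h2⟩ := hγ.exitTime_mem hk ht hu hex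
  refine ⟨t + exitTime Ω t γ, _, h2, hγ.reaches hk ht hu (by linarith), ?_⟩
  rwa [add_sub_cancel_left]

lemma valueFun_le_add (hk : IsSpeed k kmin kmax L) (hg0 : ∀ x ∈ frontier Ω, 0 ≤ g x)
    (hne : (frontier Ω).Nonempty) {lam : ℝ} (hlam : 0 < lam) (hlamk : lam < 1 / kmax)
    (hglip : ∀ x ∈ frontier Ω, ∀ y ∈ frontier Ω, |g x - g y| ≤ lam * ‖x - y‖)
    {M : ℝ} {t₀ t₁ : ℝ} (ht₀ : 0 ≤ t₀) (ht₁ : 0 ≤ t₁) {x₀ x₁ : Evec d}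
    (hM : valueFun Ω k g t₀ x₀ ≤ M) :
    valueFun Ω k g t₁ x₁ ≤ valueFun Ω k g t₀ x₀ + (|t₁ - t₀| +
      (‖x₁ - x₀‖ + kmax * |t₁ - t₀|) * Real.exp (L / kmin * kmax * (M + 1)) / kmin) := by
  have hmin := hk.min_pos
  have hmax := hk.max_pos
  have hL := hk.lip_nonneg
  set D := Real.exp (L / kmin * kmax * (M + 1)) with hD
  set A := (‖x₁ - x₀‖ + kmax * |t₁ - t₀|) with hA
  have hA0 : 0 ≤ A := by positivity
  refine le_of_forall_pos_lt_add' ?_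
  intro ε hε
  obtain ⟨T, y, hy, hr, hlt⟩ := exists_reaches_lt (g := g) hk hne ht₀ x₀ (lt_min hε one_pos)
  have hgy := hg0 y hy
  have hT := hr.1
  have hε1 : min ε 1 ≤ 1 := min_le_right _ _
  have hεε : min ε 1 ≤ ε := min_le_left _ _
  have hDle : ∀ s, s ≤ M + 1 → Real.exp (L / kmin * kmax * s) ≤ D := fun s hs =>
    Real.exp_le_exp.2 (mul_le_mul_of_nonneg_left hs (by positivity))
  have hD1 : 1 ≤ D := by
    have := hDle 0 (by linarith)
    simpa using this
  have finish : ∀ S y', Reaches k t₁ x₁ S y' → S - t₁ ≤ T - t₀ + |t₁ - t₀| → ‖y - y'‖ ≤ A * D →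
      valueFun Ω k g t₁ x₁ < valueFun Ω k g t₀ x₀ + (|t₁ - t₀| + A * D / kmin) + ε := by
    intro S y' h hS hyy
    have h1 := (h.trans hk ht₁ (Reaches.straight hk (ht₁.trans h.1) y' y)).valueFun_le
      hk hg0 hlam hlamk hglip ht₁ hy
    have h2 : ‖y - y'‖ / kmin ≤ A * D / kmin := by gcongr
    linarith
  rcases le_total t₁ t₀ with h | h
  · obtain ⟨y', hr', hyy⟩ := hr.perturb hk ht₀ x₁
    have h0 := Reaches.of_const hk ht₁ h x₁ 0 (by simpa using hmin.le)
    rw [smul_zero, add_zero] at h0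
    refine finish T y' (h0.trans hk ht₁ hr') (by linarith [neg_abs_le (t₁ - t₀)]) ?_
    rw [norm_sub_rev]
    refine hyy.trans (mul_le_mul ?_ (hDle _ (by linarith)) (by positivity) hA0)
    exact le_add_of_nonneg_right (by positivity)
  · have habs : |t₁ - t₀| = t₁ - t₀ := abs_of_nonneg (by linarith)
    rcases le_total t₁ T with h' | h'
    · obtain ⟨z, hz, hzT⟩ := hr.split hk ht₀ h h'
      obtain ⟨y', hr', hyy⟩ := hzT.perturb hk ht₁ x₁
      refine finish T y' hr' (by linarith) ?_
      rw [norm_sub_rev]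
      refine hyy.trans (mul_le_mul ?_ (hDle _ (by linarith)) (by positivity) hA0)
      have h1 := hz.norm_sub_le hk ht₀
      rw [norm_sub_rev] at h1
      rw [hA, habs]
      linarith [norm_sub_le_norm_sub_add_norm_sub x₁ x₀ z]
    · have h0 := Reaches.of_const hk ht₁ le_rfl x₁ 0 (by simpa using hmin.le)
      rw [smul_zero, add_zero] at h0
      refine finish t₁ x₁ h0 (by linarith) ?_
      have h1 := hr.norm_sub_le hk ht₀
      have h2 : kmax * (T - t₀) ≤ kmax * (t₁ - t₀) :=
        mul_le_mul_of_nonneg_left (by linarith) hmax.le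
      have h3 : ‖y - x₁‖ ≤ A := by
        rw [hA, habs]
        have := norm_sub_le_norm_sub_add_norm_sub y x₀ x₁
        rw [norm_sub_rev x₀ x₁] at this
        linarith
      exact h3.trans (le_mul_of_one_le_right hA0 hD1)

end Value

/-- The value function is Lipschitz continuous on `[0,∞) × Ω`. -/
theorem value_function_lipschitz
    (Ω : Set (Evec d)) (hΩcomp : IsCompact Ω) (hΩreg : Ω = closure (interior Ω))
    (hΩne : (interior Ω).Nonempty)
    (k : ℝ → Evec d → ℝ) (kmin kmax L₁ : ℝ)
    (hkcont : ContinuousOn (fun p : ℝ × Evec d => k p.1 p.2) (Set.Ici 0 ×ˢ Set.univ))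
    (hkmin : 0 < kmin)
    (hkbdd : ∀ t x, 0 ≤ t → kmin ≤ k t x ∧ k t x ≤ kmax)
    (hklip : ∀ t, 0 ≤ t → ∀ x₁ x₂ : Evec d, |k t x₁ - k t x₂| ≤ L₁ * ‖x₁ - x₂‖)
    (g : Evec d → ℝ) (hgcont : ContinuousOn g (frontier Ω))
    (hg0 : ∀ x ∈ frontier Ω, 0 ≤ g x)
    (lam : ℝ) (hlam : 0 < lam) (hlamk : lam < 1 / kmax)
    (hglip : ∀ x ∈ frontier Ω, ∀ y ∈ frontier Ω, |g x - g y| ≤ lam * ‖x - y‖) :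
    ∃ K : ℝ≥0, LipschitzOnWith K (fun p : ℝ × Evec d => valueFun Ω k g p.1 p.2)
      (Set.Ici 0 ×ˢ Ω) := by
  rcases (frontier Ω).eq_empty_or_nonempty with hemp | hne
  · have h0 : ∀ t x, valueFun Ω k g t x = 0 := by
      intro t x
      have : costSet Ω k g t x = ∅ := by
        refine eq_empty_of_forall_notMem ?_
        rintro r ⟨u, γ, -, -, ⟨τ, -, hτ⟩, -⟩
        simp [hemp] at hτ
      rw [valueFun, this, Real.sInf_empty]
    exact ⟨0, fun p _ q _ => by simp [h0]⟩
  have hk : IsSpeed k kmin kmax |L₁| := ⟨hkcont, hkmin, hkbdd, abs_nonneg _, fun t ht x₁ x₂ =>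
    (hklip t ht x₁ x₂).trans (mul_le_mul_of_nonneg_right (le_abs_self _) (norm_nonneg _))⟩
  have hmax := hk.max_pos
  obtain ⟨y₀, hy₀⟩ := hne
  obtain ⟨R, hR⟩ := hΩcomp.isBounded.subset_closedBall y₀
  have hM : ∀ t, 0 ≤ t → ∀ x ∈ Ω, valueFun Ω k g t x ≤ R / kmin + g y₀ := by
    intro t ht x hx
    have h1 := (Reaches.straight hk ht x y₀).valueFun_le hk hg0 hlam hlamk hglip ht hy₀
    have h2 : ‖y₀ - x‖ ≤ R := by
      rw [← dist_eq_norm, dist_comm]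
      exact hR hx
    have h3 : ‖y₀ - x‖ / kmin ≤ R / kmin := by gcongr
    linarith
  set D := Real.exp (|L₁| / kmin * kmax * (R / kmin + g y₀ + 1))
  refine ⟨⟨1 + (1 + kmax) * D / kmin, by positivity⟩, LipschitzOnWith.of_le_add_mul _ ?_⟩
  rintro ⟨t₁, x₁⟩ ⟨ht₁, hx₁⟩ ⟨t₀, x₀⟩ ⟨ht₀, hx₀⟩
  refine (valueFun_le_add hk hg0 ⟨y₀, hy₀⟩ hlam hlamk hglip ht₀ ht₁ (x₁ := x₁)
    (hM t₀ ht₀ x₀ hx₀)).trans ?_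
  have h1 : |t₁ - t₀| ≤ dist (t₁, x₁) (t₀, x₀) := by
    rw [Prod.dist_eq, ← Real.dist_eq]
    exact le_max_left _ _
  have h2 : ‖x₁ - x₀‖ ≤ dist (t₁, x₁) (t₀, x₀) := by
    rw [Prod.dist_eq, ← dist_eq_norm]
    exact le_max_right _ _
  set δ := dist (t₁, x₁) (t₀, x₀)
  gcongr
  calc |t₁ - t₀| + (‖x₁ - x₀‖ + kmax * |t₁ - t₀|) * D / kmin
      ≤ δ + (δ + kmax * δ) * D / kmin := by gcongr
    _ = (1 + (1 + kmax) * D / kmin) * δ := by ring
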